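/- Let m, s, k ∈ ℕ with s < k ≤ m and set p = 2^{−20}k^{−2}. Let F be a graph on s+1 vertices, fix w ∈ V(F) and let F⁻ = F − w. Let G̃′ ⊆ G̃ be graphs on a common vertex set U of size m, and suppose that ℑ_{F⁻, G̃′, G̃}[W] is (p, 2^{−5}pm)-Janson for every W ⊆ U with |W| ≥ m/16. Then, for a new vertex v ∉ U, the number of sets A ⊆ U for which there exists B ⊆ A with |B| ≥ m/8 such that the hypergraph ℑ_{F, G̃′⊕_v B, G̃⊕_v A} has no edges is at most 2·exp(−2^{−7}m)·2^m. (Equivalently, for G ∼ 𝔾(m+1,1/2) conditioned on G[U] = G̃, the probability that there exists G′ ⊆ G with G′[U] = G̃′, d_{G′}(v) ≥ m/8 and ℑ_{F,G′,G} = ∅ is at most 2·exp(−2^{−7}m).) -/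

import Mathlib

open scoped Classical

noncomputable section

/-- Total mass `e(ν)` of a measure `ν` on the hypergraph `G`. -/
def eMass {V : Type*} (G : Finset (Finset V)) (ν : Finset V → ℝ) : ℝ := ∑ E ∈ G, ν E

/-- Degree `d_ν(L)` of a set `L` in the measure `ν`. -/
def dMass {V : Type*} (G : Finset (Finset V)) (ν : Finset V → ℝ) (L : Finset V) : ℝ :=
  ∑ E ∈ G.filter (fun E => L ⊆ E), ν E

/-- `Λ_p(ν) = Σ_{L ⊆ V, |L| ≥ 2} d_ν(L)² p^{−|L|}`. -/
def lamP {V : Type*} [Fintype V] (p : ℝ) (G : Finset (Finset V)) (ν : Finset V → ℝ) : ℝ :=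
  ∑ L ∈ (Finset.univ : Finset (Finset V)).filter (fun L => 2 ≤ L.card),
    dMass G ν L ^ 2 / p ^ L.card

/-- `ν` is a (nonnegative) measure supported on the edges of `G`. -/
def IsMeasureOn {V : Type*} (G : Finset (Finset V)) (ν : Finset V → ℝ) : Prop :=
  (∀ E, 0 ≤ ν E) ∧ ∀ E, E ∉ G → ν E = 0

/-- The induced subhypergraph `G[X]`. -/
def indHG {V : Type*} (G : Finset (Finset V)) (X : Finset V) : Finset (Finset V) :=
  G.filter (fun E => E ⊆ X)

/-- `G` is `(p,R)`-Janson: for `R > 0` there is a measure `ν` on `G` with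
`Λ_p(ν) < e(ν)²/R`; for `R = 0` every hypergraph is `(p,R)`-Janson. -/
def IsJanson {V : Type*} [Fintype V] (p R : ℝ) (G : Finset (Finset V)) : Prop :=
  0 < R → ∃ ν : Finset V → ℝ, IsMeasureOn G ν ∧ lamP p G ν < eMass G ν ^ 2 / R

/-- The hypergraph `ℑ_{F,G',G}` of copies of `F` whose induced subgraph in `G'` and `G`
coincide and are isomorphic to `F`. -/
def copyHG {W V : Type*} [Fintype V] (F : SimpleGraph W) (G' G : SimpleGraph V) :
    Finset (Finset V) :=
  Finset.univ.filter fun L : Finset V =>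
    (∀ x ∈ L, ∀ y ∈ L, G'.Adj x y ↔ G.Adj x y) ∧
    Nonempty (F ≃g G.induce (L : Set V))

/-- `G ⊕_v A`: the graph on `V ∪ {v}` (modelled as `Option V`, with `v = none ∉ V`)
obtained from `G` by joining the new vertex to exactly the vertices of `A`. -/
def extendGraph {V : Type*} (G : SimpleGraph V) (A : Finset V) : SimpleGraph (Option V) :=
  SimpleGraph.fromRel (fun x y =>
    match x, y with
    | some a, some b => G.Adj a b
    | some a, none => a ∈ A
    | none, some _ => False
    | none, none => False)


lemma sum_pow_card_powerset (r : ℝ) {V : Type*} (C : Finset V) :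
    ∑ A ∈ C.powerset, r ^ A.card = (1 + r) ^ C.card := by
  simpa [add_comm] using Finset.sum_pow_mul_eq_add_pow r 1 C

section Janson

variable {V ι : Type*} [DecidableEq V]

/-- The sum of the `a i` over those `i ∈ s` for which `E i ⊆ T`. -/
def containedSum (s : Finset ι) (E : ι → Finset V) (a : ι → ℝ) (T : Finset V) : ℝ :=
  ∑ i ∈ s, if E i ⊆ T then a i else 0

lemma containedSum_nonneg {s : Finset ι} {E : ι → Finset V} {a : ι → ℝ} (ha : ∀ i, 0 ≤ a i)
    (T : Finset V) : 0 ≤ containedSum s E a T :=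
  Finset.sum_nonneg fun i _ => by split_ifs <;> simp [ha i]

lemma containedSum_mono {s : Finset ι} {E : ι → Finset V} {a : ι → ℝ} (ha : ∀ i, 0 ≤ a i) :
    Monotone (containedSum s E a) := by
  intro A B h
  refine Finset.sum_le_sum fun i _ => ?_
  by_cases h1 : E i ⊆ A
  · rw [if_pos h1, if_pos (h1.trans h)]
  · rw [if_neg h1]
    split_ifs <;> simp [ha i]

lemma exp_containedSum_antitone {s : Finset ι} {E : ι → Finset V} {a : ι → ℝ}
    (ha : ∀ i, 0 ≤ a i) {t : ℝ} (ht : 0 ≤ t) :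
    Antitone fun T => Real.exp (-t * containedSum s E a T) := fun A B h => by
  have := mul_le_mul_of_nonneg_left (containedSum_mono (s := s) (E := E) ha h) ht
  exact Real.exp_le_exp.2 (by linarith)

lemma exp_containedSum_le_one {s : Finset ι} {E : ι → Finset V} {a : ι → ℝ}
    (ha : ∀ i, 0 ≤ a i) {t : ℝ} (ht : 0 ≤ t) (T : Finset V) :
    Real.exp (-t * containedSum s E a T) ≤ 1 := by
  have := mul_nonneg ht (containedSum_nonneg (s := s) (E := E) ha T)
  exact Real.exp_le_one_iff.2 (by linarith)

variable [Fintype V]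

/-- The sum of `r ^ |T| * f T` over all `T` with `E ⊆ T ⊆ C`. -/
def weightedSum (r : ℝ) (C E : Finset V) (f : Finset V → ℝ) : ℝ :=
  ∑ T : Finset V, (if E ⊆ T ∧ T ⊆ C then r ^ T.card else 0) * f T

lemma weightedSum_mono {r : ℝ} (hr : 0 ≤ r) (C E : Finset V) {f g : Finset V → ℝ}
    (hfg : ∀ T, f T ≤ g T) : weightedSum r C E f ≤ weightedSum r C E g := by
  unfold weightedSum
  refine Finset.sum_le_sum fun T _ => mul_le_mul_of_nonneg_left (hfg T) ?_
  split_ifs <;> positivity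

lemma weightedSum_nonneg {r : ℝ} (hr : 0 ≤ r) (C E : Finset V) {f : Finset V → ℝ}
    (hf : ∀ T, 0 ≤ f T) : 0 ≤ weightedSum r C E f := by
  unfold weightedSum
  refine Finset.sum_nonneg fun T _ => mul_nonneg ?_ (hf T)
  split_ifs <;> positivity

lemma weightedSum_sdiff {r : ℝ} {C E : Finset V} (hE : E ⊆ C) {f : Finset V → ℝ}
    (hf : ∀ T, f (T \ E) = f T) :
    weightedSum r C E f = r ^ E.card * ∑ A ∈ (C \ E).powerset, r ^ A.card * f A := by
  unfold weightedSum
  simp_rw [ite_mul, zero_mul]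
  rw [← Finset.sum_filter, Finset.mul_sum]
  refine Finset.sum_nbij' (fun T => T \ E) (fun A => A ∪ E) ?_ ?_ ?_ ?_ ?_
  · intro T hT
    simp only [Finset.mem_filter, Finset.mem_univ, true_and] at hT
    simpa using Finset.sdiff_subset_sdiff hT.2 (le_refl E)
  · intro A hA
    simp only [Finset.mem_powerset] at hA
    simp only [Finset.mem_filter, Finset.mem_univ, true_and]
    exact ⟨Finset.subset_union_right, Finset.union_subset (hA.trans Finset.sdiff_subset) hE⟩
  · intro T hT
    simp only [Finset.mem_filter, Finset.mem_univ, true_and] at hT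
    exact Finset.sdiff_union_of_subset hT.1
  · intro A hA
    simp only [Finset.mem_powerset] at hA
    exact Finset.union_sdiff_cancel_right (Finset.disjoint_of_subset_left hA Finset.sdiff_disjoint)
  · intro T hT
    simp only [Finset.mem_filter, Finset.mem_univ, true_and] at hT
    rw [hf, ← mul_assoc, ← pow_add, add_comm, Finset.card_sdiff_add_card_eq_card hT.1]

lemma weightedSum_empty {r : ℝ} {C E : Finset V} (hE : E ⊆ C) {f : Finset V → ℝ}
    (hf : ∀ T, f (T \ E) = f T) :
    weightedSum r C ∅ f = (1 + r) ^ E.card * ∑ A ∈ (C \ E).powerset, r ^ A.card * f A := by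
  rw [weightedSum_sdiff (Finset.empty_subset C) (by simp)]
  simp only [Finset.card_empty, pow_zero, one_mul, Finset.sdiff_empty]
  rw [← sum_pow_card_powerset, Finset.sum_mul_sum, ← Finset.sum_product']
  refine Finset.sum_nbij' (fun T => (T ∩ E, T \ E)) (fun A => A.1 ∪ A.2) ?_ ?_ ?_ ?_ ?_
  · intro T hT
    simp only [Finset.mem_powerset] at hT
    simpa using Finset.sdiff_subset_sdiff hT (le_refl E)
  · intro A hA
    simp only [Finset.mem_product, Finset.mem_powerset] at hA
    simpa using Finset.union_subset (hA.1.trans hE) (hA.2.trans Finset.sdiff_subset)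
  · intro T hT
    simp only
    rw [Finset.union_comm, Finset.sdiff_union_inter]
  · rintro ⟨A, B⟩ hA
    simp only [Finset.mem_product, Finset.mem_powerset] at hA
    ext x <;> have h1 := @hA.1 x <;> have h2 := @hA.2 x <;> simp at * <;> tauto
  · intro T hT
    simp only
    rw [hf, ← mul_assoc, ← pow_add, Finset.card_inter_add_card_sdiff]

/-- Conditioning on `E ⊆ T` does not affect a function of `T \ E`. -/
lemma weightedSum_eq_of_sdiff {r : ℝ} (hr : 0 < r) {C E : Finset V} (hE : E ⊆ C)
    {f : Finset V → ℝ} (hf : ∀ T, f (T \ E) = f T) :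
    weightedSum r C E f = (r / (1 + r)) ^ E.card * weightedSum r C ∅ f := by
  rw [weightedSum_sdiff hE hf, weightedSum_empty hE hf, div_pow]
  field_simp

lemma weightedSum_one {r : ℝ} (hr : 0 < r) {C E : Finset V} (hE : E ⊆ C) :
    weightedSum r C E (fun _ => 1) = (r / (1 + r)) ^ E.card * (1 + r) ^ C.card := by
  rw [weightedSum_eq_of_sdiff hr hE (fun _ => rfl),
    weightedSum_empty (le_refl C) (fun _ => rfl)]
  simp

/-- The Harris inequality for two decreasing functions with values in `[0, 1]`. -/
lemma weightedSum_harris {r : ℝ} (hr : 0 ≤ r) (C E : Finset V) {f g : Finset V → ℝ}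
    (hf : Antitone f) (hg : Antitone g) (hf1 : ∀ T, f T ≤ 1) (hg1 : ∀ T, g T ≤ 1) :
    weightedSum r C E f * weightedSum r C E g ≤
      weightedSum r C E (fun _ => 1) * weightedSum r C E (fun T => f T * g T) := by
  have key := fkg (α := Finset V) (μ := fun T => if E ⊆ T ∧ T ⊆ C then r ^ T.card else 0)
    (f := fun T => 1 - f T) (g := fun T => 1 - g T)
    (fun T => by dsimp only; split_ifs <;> positivity)
    (fun T => by simpa using hf1 T) (fun T => by simpa using hg1 T)
    (fun A B h => by linarith [hf h]) (fun A B h => by linarith [hg h])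
    (fun A B => by
      by_cases hA : E ⊆ A ∧ A ⊆ C
      · by_cases hB : E ⊆ B ∧ B ⊆ C
        · rw [if_pos hA, if_pos hB, if_pos, if_pos, ← pow_add, ← pow_add]
          · rw [Finset.inf_eq_inter, Finset.sup_eq_union, Finset.card_inter_add_card_union]
          · exact ⟨hA.1.trans le_sup_left, sup_le hA.2 hB.2⟩
          · exact ⟨le_inf hA.1 hB.1, inf_le_left.trans hA.2⟩
        · rw [if_neg hB, mul_zero]
          split_ifs <;> positivity
      · rw [if_neg hA, zero_mul]
        split_ifs <;> positivity)
  simp only [weightedSum] at key ⊢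
  simp only [mul_sub, sub_mul, mul_one, one_mul, Finset.sum_sub_distrib, sub_sub,
    Finset.sum_add_distrib, mul_add] at key ⊢
  nlinarith [key]

lemma weightedSum_mul_indicator {r : ℝ} (C E E' : Finset V) (f : Finset V → ℝ) (c : ℝ) :
    weightedSum r C E (fun T => (if E' ⊆ T then c else 0) * f T) =
      c * weightedSum r C (E ∪ E') f := by
  unfold weightedSum
  rw [Finset.mul_sum]
  refine Finset.sum_congr rfl fun T _ => ?_
  simp only [Finset.union_subset_iff]
  by_cases h1 : E ⊆ T <;> by_cases h2 : E' ⊆ T <;> by_cases h3 : T ⊆ C <;> simp [h1, h2, h3]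
  ring

lemma weightedSum_containedSum_mul {r : ℝ} (C E' : Finset V) (s : Finset ι) (E : ι → Finset V)
    (a : ι → ℝ) (f : Finset V → ℝ) :
    weightedSum r C E' (fun T => containedSum s E a T * f T) =
      ∑ i ∈ s, a i * weightedSum r C (E' ∪ E i) f := by
  simp_rw [← weightedSum_mul_indicator]
  unfold weightedSum containedSum
  rw [Finset.sum_comm]
  refine Finset.sum_congr rfl fun T _ => ?_
  dsimp only
  rw [Finset.sum_mul, Finset.mul_sum]

lemma weightedSum_exp_conditioned {r : ℝ} (hr : 0 < r) {C : Finset V} {s : Finset ι}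
    {E : ι → Finset V} (hE : ∀ i ∈ s, E i ⊆ C) {ν : ι → ℝ} (hν : ∀ i, 0 ≤ ν i) {t : ℝ}
    (ht : 0 ≤ t) {p : ℝ} (hp : p = r / (1 + r)) {D : Finset V} (hD : D ⊆ C) :
    p ^ D.card * (weightedSum r C ∅
        (fun T => Real.exp (-t * containedSum s E (fun i => ν i / p ^ (E i).card) T)) *
      (1 - t * ∑ j ∈ s with (D ∩ E j).Nonempty, ν j / p ^ (D ∩ E j).card)) ≤
      weightedSum r C D
        (fun T => Real.exp (-t * containedSum s E (fun i => ν i / p ^ (E i).card) T)) := by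
  have hp0 : 0 < p := hp ▸ by positivity
  set a : ι → ℝ := fun i => ν i / p ^ (E i).card with ha_def
  have ha : ∀ i, 0 ≤ a i := fun i => by have := hν i; positivity
  set A := containedSum (s.filter fun j => (D ∩ E j).Nonempty) E a with hA
  set B := containedSum (s.filter fun j => ¬ (D ∩ E j).Nonempty) E a with hB
  have hX : ∀ T, containedSum s E a T = A T + B T := fun T =>
    (Finset.sum_filter_add_sum_filter_not _ _ _).symm
  have hBD : ∀ T, B (T \ D) = B T := by
    intro T
    refine Finset.sum_congr rfl fun j hj => ?_
    have hj2 : Disjoint (E j) D := by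
      rw [Finset.mem_filter, Finset.not_nonempty_iff_eq_empty] at hj
      rw [disjoint_comm, Finset.disjoint_iff_inter_eq_empty]
      exact hj.2
    have : E j ⊆ T \ D ↔ E j ⊆ T := by
      rw [Finset.subset_sdiff]
      tauto
    simp only [this]
  set M := weightedSum r C ∅ (fun T => Real.exp (-t * containedSum s E a T))
  set N : ℝ := (1 + r) ^ C.card with hN
  have hN0 : 0 < N := by positivity
  have hM0 : 0 ≤ M := weightedSum_nonneg hr.le _ _ fun T => (Real.exp_pos _).le
  have harris := weightedSum_harris hr.le C D
    (exp_containedSum_antitone (s := s.filter fun j => (D ∩ E j).Nonempty) (E := E) ha ht)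
    (exp_containedSum_antitone (s := s.filter fun j => ¬ (D ∩ E j).Nonempty) (E := E) ha ht)
    (exp_containedSum_le_one ha ht) (exp_containedSum_le_one ha ht)
  have hprod : (fun T => Real.exp (-t * A T) * Real.exp (-t * B T)) =
      fun T => Real.exp (-t * containedSum s E a T) := by
    funext T
    rw [← Real.exp_add, hX]
    ring_nf
  rw [← hA, ← hB, hprod, weightedSum_one hr hD, ← hp, ← hN] at harris
  have h1 : p ^ D.card * M ≤ weightedSum r C D (fun T => Real.exp (-t * B T)) := by
    rw [weightedSum_eq_of_sdiff hr hD (fun T => by rw [hBD]), ← hp]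
    refine mul_le_mul_of_nonneg_left (weightedSum_mono hr.le _ _ fun T => ?_) (by positivity)
    have := mul_nonneg ht (containedSum_nonneg (s := s.filter fun j => (D ∩ E j).Nonempty)
      (E := E) ha T)
    rw [Real.exp_le_exp, hX]
    linarith
  have h2 : p ^ D.card * N *
      (1 - t * ∑ j ∈ s with (D ∩ E j).Nonempty, ν j / p ^ (D ∩ E j).card) ≤
      weightedSum r C D (fun T => Real.exp (-t * A T)) := by
    calc _ = weightedSum r C D (fun T => 1 + (-t) * (A T * 1)) := by
          have e1 : weightedSum r C D (fun T => 1 + (-t) * (A T * 1)) =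
              weightedSum r C D (fun _ => 1) + (-t) * weightedSum r C D (fun T => A T * 1) := by
            unfold weightedSum
            rw [Finset.mul_sum, ← Finset.sum_add_distrib]
            exact Finset.sum_congr rfl fun T _ => by ring
          rw [e1, hA, weightedSum_containedSum_mul, weightedSum_one hr hD, ← hp, ← hN, mul_sub,
            mul_one, sub_eq_add_neg, neg_mul, add_right_inj, neg_inj, mul_left_comm,
            Finset.mul_sum]
          congr 1
          refine Finset.sum_congr rfl fun j hj => ?_
          rw [weightedSum_one hr (Finset.union_subset hD (hE j (Finset.mem_filter.1 hj).1)),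
            ← hp, ← hN, ha_def]
          have hc := Finset.card_union_add_card_inter D (E j)
          have : p ^ (D ∪ E j).card * p ^ (D ∩ E j).card = p ^ D.card * p ^ (E j).card := by
            rw [← pow_add, ← pow_add, hc]
          field_simp
          linear_combination (-ν j) * this
      _ ≤ _ := weightedSum_mono hr.le _ _ fun T => by
          have := Real.add_one_le_exp (-t * A T)
          linarith
  have h3 := (mul_le_mul_of_nonneg_right h2 (by positivity : 0 ≤ p ^ D.card * M)).trans
    ((mul_le_mul_of_nonneg_left h1
      (weightedSum_nonneg hr.le _ _ fun T => (Real.exp_pos _).le)).trans harris)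
  have hq : 0 < p ^ D.card * N := by positivity
  refine le_of_mul_le_mul_left ?_ hq
  linarith

/-- Janson's inequality for weighted families, unnormalised: the hard-core sum over the sets
containing none of the `E i`. -/
theorem sum_pow_card_le_janson {r : ℝ} (hr : 0 < r) {C : Finset V} {s : Finset ι}
    {E : ι → Finset V} (hE : ∀ i ∈ s, E i ⊆ C) {ν : ι → ℝ} (hν : ∀ i, 0 ≤ ν i) {t : ℝ}
    (ht : 0 ≤ t) {p : ℝ} (hp : p = r / (1 + r)) :
    ∑ T ∈ C.powerset with ∀ i ∈ s, ¬ E i ⊆ T, r ^ T.card ≤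
      (1 + r) ^ C.card * Real.exp (-t * ∑ i ∈ s, ν i + t ^ 2 / 2 *
        ∑ i ∈ s, ν i * ∑ j ∈ s with (E i ∩ E j).Nonempty, ν j / p ^ (E i ∩ E j).card) := by
  have hp0 : 0 < p := hp ▸ by positivity
  set a : ι → ℝ := fun i => ν i / p ^ (E i).card with ha_def
  have ha : ∀ i, 0 ≤ a i := fun i => by have := hν i; positivity
  set X := containedSum s E a with hX
  set e := ∑ i ∈ s, ν i with he
  set Δ := ∑ i ∈ s, ν i * ∑ j ∈ s with (E i ∩ E j).Nonempty, ν j / p ^ (E i ∩ E j).card with hΔ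
  set g : ℝ → ℝ := fun t => weightedSum r C ∅ (fun T => Real.exp (-t * X T)) with hg
  set g' : ℝ → ℝ := fun t => weightedSum r C ∅ (fun T => X T * Real.exp (-t * X T)) with hg'
  have hderiv : ∀ t, HasDerivAt g (-g' t) t := by
    intro t
    have : -g' t = ∑ T : Finset V, (if ∅ ⊆ T ∧ T ⊆ C then r ^ T.card else 0) *
        (Real.exp (-t * X T) * (-1 * X T)) := by
      simp only [hg', weightedSum, ← Finset.sum_neg_distrib]
      exact Finset.sum_congr rfl fun T _ => by ring
    rw [this]
    refine HasDerivAt.fun_sum fun T _ => HasDerivAt.const_mul _ ?_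
    exact (((hasDerivAt_id t).neg).mul_const (X T)).exp
  have hkey : ∀ t, 0 ≤ t → g t * (e - t * Δ) ≤ g' t := by
    intro t ht
    simp only [hg', hX, weightedSum_containedSum_mul, Finset.empty_union]
    rw [he, hΔ, Finset.mul_sum, ← Finset.sum_sub_distrib, Finset.mul_sum]
    refine Finset.sum_le_sum fun i hi => ?_
    have h := mul_le_mul_of_nonneg_left
      (weightedSum_exp_conditioned hr hE hν ht hp (hE i hi)) (ha i)
    refine le_trans (le_of_eq ?_) h
    simp only [hg, ha_def, hX]
    field_simp
  set h : ℝ → ℝ := fun t => g t * Real.exp (t * e - t ^ 2 / 2 * Δ) with hh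
  have hhd : ∀ t, HasDerivAt h (-g' t * Real.exp (t * e - t ^ 2 / 2 * Δ) +
      g t * (Real.exp (t * e - t ^ 2 / 2 * Δ) * (e - t * Δ))) t := by
    intro t
    refine (hderiv t).mul (HasDerivAt.exp ?_)
    have h1 := ((hasDerivAt_id t).mul_const e).sub
      ((((hasDerivAt_id t).pow 2).div_const 2).mul_const Δ)
    exact h1.congr_deriv (by simp)
  have hanti : AntitoneOn h (Set.Ici 0) := by
    refine antitoneOn_of_hasDerivWithinAt_nonpos (convex_Ici 0)
      (fun t _ => (hhd t).continuousAt.continuousWithinAt)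
      (fun t _ => (hhd t).hasDerivWithinAt) fun t ht => ?_
    have ht0 : 0 ≤ t := interior_subset ht
    have := mul_le_mul_of_nonneg_right (hkey t ht0)
      (Real.exp_pos (t * e - t ^ 2 / 2 * Δ)).le
    linarith
  have h0 : h 0 = (1 + r) ^ C.card := by
    have := weightedSum_one hr (Finset.empty_subset C)
    simp only [Finset.card_empty, pow_zero, one_mul] at this
    simpa [hh, hg] using this
  have hle : g t ≤ (1 + r) ^ C.card * Real.exp (-t * e + t ^ 2 / 2 * Δ) := by
    have h1 : h t ≤ h 0 := hanti (Set.self_mem_Ici) ht ht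
    rw [h0] at h1
    have h2 := mul_le_mul_of_nonneg_right h1 (Real.exp_pos (-t * e + t ^ 2 / 2 * Δ)).le
    refine le_trans (le_of_eq ?_) h2
    simp only [hh]
    have h3 : t * e - t ^ 2 / 2 * Δ + (-t * e + t ^ 2 / 2 * Δ) = 0 := by ring
    rw [mul_assoc, ← Real.exp_add, h3, Real.exp_zero, mul_one]
  refine le_trans ?_ hle
  simp only [hg, weightedSum, ite_mul, zero_mul, Finset.empty_subset, true_and]
  rw [← Finset.sum_filter]
  calc _ = ∑ T ∈ C.powerset with ∀ i ∈ s, ¬ E i ⊆ T, r ^ T.card * Real.exp (-t * X T) := by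
        refine Finset.sum_congr rfl fun T hT => ?_
        have : X T = 0 := Finset.sum_eq_zero fun i hi => if_neg ((Finset.mem_filter.1 hT).2 i hi)
        simp [this]
    _ ≤ _ := Finset.sum_le_sum_of_subset_of_nonneg
        (fun T hT => by simp at hT ⊢; exact hT.1) fun T _ _ => by positivity

end Janson

section Container

open MeasureTheory

variable {V : Type*} [DecidableEq V]

/-- The sum of `r ^ |T|` over the sets `T ⊆ C` for which `T ∪ S` is independent. -/
def hardCoreSum (Ind : Finset V → Prop) (S C : Finset V) (r : ℝ) : ℝ :=
  ∑ T ∈ C.powerset with Ind (T ∪ S), r ^ T.card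

variable {Ind : Finset V → Prop}

lemma one_le_hardCoreSum {S : Finset V} (hS : Ind S) (C : Finset V) {r : ℝ} (hr : 0 ≤ r) :
    1 ≤ hardCoreSum Ind S C r := by
  have h : ∅ ∈ C.powerset.filter (fun T => Ind (T ∪ S)) := by simpa using hS
  have := Finset.single_le_sum (f := fun T : Finset V => r ^ T.card)
    (fun T _ => by positivity) h
  simpa [hardCoreSum] using this

lemma hardCoreSum_zero {S : Finset V} (hS : Ind S) (C : Finset V) :
    hardCoreSum Ind S C 0 = 1 := by
  have h : ∅ ∈ C.powerset.filter (fun T => Ind (T ∪ S)) := by simpa using hS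
  unfold hardCoreSum
  rw [Finset.sum_eq_single_of_mem ∅ h]
  · simp
  · intro T _ hT
    simpa [zero_pow_eq_zero] using hT

lemma hardCoreSum_mono (S : Finset V) {C C' : Finset V} (h : C ⊆ C') {r : ℝ} (hr : 0 ≤ r) :
    hardCoreSum Ind S C r ≤ hardCoreSum Ind S C' r :=
  Finset.sum_le_sum_of_subset_of_nonneg
    (Finset.filter_subset_filter _ (Finset.powerset_mono.2 h)) fun _ _ _ => by positivity

lemma hardCoreSum_le_empty (hInd : ∀ A B : Finset V, A ⊆ B → Ind B → Ind A) (S C : Finset V)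
    {r : ℝ} (hr : 0 ≤ r) : hardCoreSum Ind S C r ≤ hardCoreSum Ind ∅ C r := by
  refine Finset.sum_le_sum_of_subset_of_nonneg (fun T hT => ?_) fun _ _ _ => by positivity
  simp only [Finset.mem_filter, Finset.union_empty] at hT ⊢
  exact ⟨hT.1, hInd _ _ Finset.subset_union_left hT.2⟩

lemma hardCoreSum_le_pow (S C : Finset V) {r : ℝ} (hr : 0 ≤ r) :
    hardCoreSum Ind S C r ≤ (1 + r) ^ C.card := by
  rw [← sum_pow_card_powerset]
  exact Finset.sum_le_sum_of_subset_of_nonneg (Finset.filter_subset _ _)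
    fun _ _ _ => by positivity

lemma hasDerivAt_hardCoreSum (S C : Finset V) (r : ℝ) :
    HasDerivAt (hardCoreSum Ind S C)
      (∑ v ∈ C, hardCoreSum Ind (insert v S) (C.erase v) r) r := by
  have h1 : HasDerivAt (hardCoreSum Ind S C)
      (∑ T ∈ C.powerset with Ind (T ∪ S), (T.card : ℝ) * r ^ (T.card - 1)) r :=
    HasDerivAt.fun_sum fun T _ => hasDerivAt_pow T.card r
  refine h1.congr_deriv ?_
  calc _ = ∑ T ∈ C.powerset with Ind (T ∪ S), ∑ v ∈ T, r ^ (T.card - 1) := by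
        simp
    _ = ∑ v ∈ C, ∑ T ∈ C.powerset with Ind (T ∪ S) ∧ v ∈ T, r ^ (T.card - 1) := by
        refine Finset.sum_comm' fun T v => ?_
        simp only [Finset.mem_filter, Finset.mem_powerset]
        exact ⟨fun h => ⟨⟨h.1.1, h.1.2, h.2⟩, h.1.1 h.2⟩, fun h => ⟨⟨h.1.1, h.1.2.1⟩, h.1.2.2⟩⟩
    _ = _ := by
        refine Finset.sum_congr rfl fun v hv => ?_
        refine Finset.sum_nbij' (fun T => T.erase v) (fun T => insert v T) ?_ ?_ ?_ ?_ ?_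
        · intro T hT
          simp only [Finset.mem_filter, Finset.mem_powerset] at hT ⊢
          refine ⟨Finset.erase_subset_erase _ hT.1, ?_⟩
          rw [Finset.union_insert, ← Finset.insert_union, Finset.insert_erase hT.2.2]
          exact hT.2.1
        · intro T hT
          simp only [Finset.mem_filter, Finset.mem_powerset] at hT ⊢
          refine ⟨Finset.insert_subset hv (hT.1.trans (Finset.erase_subset _ _)), ?_,
            Finset.mem_insert_self _ _⟩
          rw [Finset.insert_union, ← Finset.union_insert]
          exact hT.2
        · intro T hT
          simp only [Finset.mem_filter] at hT
          exact Finset.insert_erase hT.2.2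
        · intro T hT
          simp only [Finset.mem_filter, Finset.mem_powerset] at hT
          exact Finset.erase_insert fun h => Finset.notMem_erase v C (hT.1 h)
        · intro T hT
          simp only [Finset.mem_filter] at hT
          rw [Finset.card_erase_of_mem hT.2.2]

lemma continuous_hardCoreSum (S C : Finset V) : Continuous (hardCoreSum Ind S C) :=
  continuous_iff_continuousAt.2 fun r => (hasDerivAt_hardCoreSum S C r).continuousAt

/-- The integral over `[0, r]` of the logarithm of the hard-core sum. -/
def hardCorePotential (Ind : Finset V → Prop) (r : ℝ) (S C : Finset V) : ℝ :=
  ∫ l in (0 : ℝ)..r, Real.log (hardCoreSum Ind S C l)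

lemma continuousOn_log_hardCoreSum {S : Finset V} (hS : Ind S) (C : Finset V) (r : ℝ) :
    ContinuousOn (fun l => Real.log (hardCoreSum Ind S C l)) (Set.Icc 0 r) :=
  (continuous_hardCoreSum S C).continuousOn.log fun l hl => by
    linarith [one_le_hardCoreSum hS C hl.1]

lemma intervalIntegrable_log_hardCoreSum {S : Finset V} (hS : Ind S) (C : Finset V) {r : ℝ}
    (hr : 0 ≤ r) :
    IntervalIntegrable (fun l => Real.log (hardCoreSum Ind S C l)) volume 0 r :=
  ContinuousOn.intervalIntegrable_of_Icc hr (continuousOn_log_hardCoreSum hS C r)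

lemma hardCorePotential_nonneg {S : Finset V} (hS : Ind S) (C : Finset V) {r : ℝ} (hr : 0 ≤ r) :
    0 ≤ hardCorePotential Ind r S C :=
  intervalIntegral.integral_nonneg hr fun _ hl => Real.log_nonneg (one_le_hardCoreSum hS C hl.1)

lemma hardCorePotential_mono {S : Finset V} (hS : Ind S) {C C' : Finset V} (h : C ⊆ C') {r : ℝ}
    (hr : 0 ≤ r) : hardCorePotential Ind r S C ≤ hardCorePotential Ind r S C' :=
  intervalIntegral.integral_mono_on hr (intervalIntegrable_log_hardCoreSum hS C hr)
    (intervalIntegrable_log_hardCoreSum hS C' hr) fun _ hl =>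
      Real.log_le_log (by linarith [one_le_hardCoreSum hS C hl.1]) (hardCoreSum_mono S h hl.1)

lemma hardCorePotential_le {S : Finset V} (hS : Ind S) (C : Finset V) {r : ℝ} (hr : 0 ≤ r) :
    hardCorePotential Ind r S C ≤ C.card * r ^ 2 := by
  have h : hardCorePotential Ind r S C ≤ ∫ _ in (0 : ℝ)..r, (C.card * r : ℝ) := by
    refine intervalIntegral.integral_mono_on hr (intervalIntegrable_log_hardCoreSum hS C hr)
      intervalIntegrable_const fun l hl => ?_
    have h1 := one_le_hardCoreSum hS C hl.1
    have h2 := Real.log_le_log (by linarith) (hardCoreSum_le_pow (Ind := Ind) S C hl.1)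
    rw [Real.log_pow] at h2
    have h3 := Real.log_le_sub_one_of_pos (x := 1 + l) (by linarith [hl.1])
    exact h2.trans (mul_le_mul_of_nonneg_left (by linarith [hl.2]) (Nat.cast_nonneg _))
  refine h.trans (le_of_eq ?_)
  rw [intervalIntegral.integral_const, sub_zero, smul_eq_mul]
  ring

/-- If the hard-core sum on `C` is small, adding a suitable vertex lowers the potential. -/
lemma exists_hardCorePotential_insert_le {S C : Finset V} (hS : Ind S)
    (hins : ∀ v ∈ C, Ind (insert v S)) {r β : ℝ} (hr : 0 ≤ r)
    (hsmall : hardCoreSum Ind S C r < Real.exp ((1 - β) * r * C.card)) :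
    ∃ v ∈ C, hardCorePotential Ind r (insert v S) (C.erase v) ≤
      hardCorePotential Ind r S C - β * r := by
  by_contra! hcon
  refine hsmall.not_ge ?_
  have hpos : ∀ l ∈ Set.Icc 0 r, 0 < hardCoreSum Ind S C l := fun l hl => by
    linarith [one_le_hardCoreSum hS C hl.1]
  set q : V → ℝ → ℝ := fun v l =>
    hardCoreSum Ind (insert v S) (C.erase v) l / hardCoreSum Ind S C l with hq
  have hqc : ∀ v, ContinuousOn (q v) (Set.Icc 0 r) := fun v =>
    (continuous_hardCoreSum _ _).continuousOn.div (continuous_hardCoreSum _ _).continuousOn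
      fun l hl => (hpos l hl).ne'
  have hqi : ∀ v, IntervalIntegrable (q v) volume 0 r := fun v =>
    ContinuousOn.intervalIntegrable_of_Icc hr (hqc v)
  have hFTC : ∫ l in (0 : ℝ)..r, ∑ v ∈ C, q v l = Real.log (hardCoreSum Ind S C r) := by
    rw [intervalIntegral.integral_eq_sub_of_hasDerivAt
      (f := fun l => Real.log (hardCoreSum Ind S C l))]
    · rw [hardCoreSum_zero hS, Real.log_one, sub_zero]
    · intro l hl
      rw [Set.uIcc_of_le hr] at hl
      refine ((hasDerivAt_hardCoreSum S C l).log (hpos l hl).ne').congr_deriv ?_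
      rw [Finset.sum_div]
    · exact ContinuousOn.intervalIntegrable_of_Icc hr (continuousOn_finsetSum C fun v _ => hqc v)
  have hv : ∀ v ∈ C, (1 - β) * r ≤ ∫ l in (0 : ℝ)..r, q v l := by
    intro v hv
    have h1 := intervalIntegrable_log_hardCoreSum (hins v hv) (C.erase v) hr
    have h2 := intervalIntegrable_log_hardCoreSum hS C hr
    have h3 : ∫ l in (0 : ℝ)..r, (Real.log (hardCoreSum Ind (insert v S) (C.erase v) l) -
        Real.log (hardCoreSum Ind S C l)) ≤ ∫ l in (0 : ℝ)..r, (q v l - 1) := by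
      refine intervalIntegral.integral_mono_on hr (h1.sub h2)
        ((hqi v).sub intervalIntegrable_const) fun l hl => ?_
      have h4 : 0 < hardCoreSum Ind (insert v S) (C.erase v) l := by
        linarith [one_le_hardCoreSum (hins v hv) (C.erase v) hl.1]
      rw [← Real.log_div h4.ne' (hpos l hl).ne']
      exact Real.log_le_sub_one_of_pos (div_pos h4 (hpos l hl))
    rw [intervalIntegral.integral_sub h1 h2,
      intervalIntegral.integral_sub (hqi v) intervalIntegrable_const] at h3
    have h5 := hcon v hv
    simp only [hardCorePotential] at h5
    simp only [intervalIntegral.integral_const, sub_zero, smul_eq_mul, mul_one] at h3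
    linarith
  have hsum := Finset.sum_le_sum hv
  rw [← intervalIntegral.integral_finsetSum fun v _ => hqi v, hFTC, Finset.sum_const,
    nsmul_eq_mul] at hsum
  rw [← Real.le_log_iff_exp_le (hpos r ⟨hr, le_refl r⟩)]
  linarith

/-- A container lemma: the independent sets are covered by few sets `K.1 ∪ K.2` with `K.1` small
and with a large hard-core sum on `K.2`. -/
theorem exists_containers (hInd : ∀ A B : Finset V, A ⊆ B → Ind B → Ind A) {r β a b : ℝ}
    (hr : 0 ≤ r) (ha : 0 ≤ a) (hb : 0 ≤ b) (hab : 1 + Real.exp (-(a * (β * r))) ≤ Real.exp b)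
    (hβ : 0 ≤ β) (C : Finset V) : ∀ S : Finset V, ∃ K : Finset (Finset V × Finset V),
      (K.card : ℝ) ≤ Real.exp (a * hardCorePotential Ind r S C + b * C.card) ∧
      (∀ P ∈ K, P.1.card * (β * r) ≤ S.card * (β * r) + hardCorePotential Ind r S C ∧
        Real.exp ((1 - β) * r * P.2.card) ≤ hardCoreSum Ind ∅ P.2 r) ∧
      ∀ I, Ind I → S ⊆ I → I ⊆ S ∪ C → ∃ P ∈ K, I ⊆ P.1 ∪ P.2 := by
  induction hn : C.card generalizing C with
  | zero =>
    obtain rfl := Finset.card_eq_zero.1 hn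
    intro S
    by_cases hS : Ind S
    · refine ⟨{(S, ∅)}, ?_, ?_, fun I _ _ hI => ⟨(S, ∅), Finset.mem_singleton_self _, hI⟩⟩
      · have := hardCorePotential_nonneg hS ∅ hr
        rw [Finset.card_singleton, Nat.cast_one]
        exact Real.one_le_exp (by positivity)
      · intro P hP
        rw [Finset.mem_singleton.1 hP]
        refine ⟨by linarith [hardCorePotential_nonneg hS ∅ hr], ?_⟩
        have := one_le_hardCoreSum (hInd ∅ S (Finset.empty_subset S) hS) ∅ hr
        simpa using this
    · exact ⟨∅, by simpa using (Real.exp_pos _).le, by simp,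
        fun I hI hSI _ => absurd (hInd _ _ hSI hI) hS⟩
  | succ n ih =>
    intro S
    by_cases hS : Ind S
    swap
    · exact ⟨∅, by simpa using (Real.exp_pos _).le, by simp,
        fun I hI hSI _ => absurd (hInd _ _ hSI hI) hS⟩
    by_cases hlarge : Real.exp ((1 - β) * r * C.card) ≤ hardCoreSum Ind S C r
    · refine ⟨{(S, C)}, ?_, ?_, fun I _ _ hI => ⟨(S, C), Finset.mem_singleton_self _, hI⟩⟩
      · have := hardCorePotential_nonneg hS C hr
        rw [Finset.card_singleton, Nat.cast_one]
        exact Real.one_le_exp (by positivity)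
      · intro P hP
        rw [Finset.mem_singleton.1 hP]
        exact ⟨by linarith [hardCorePotential_nonneg hS C hr],
          hlarge.trans (hardCoreSum_le_empty hInd S C hr)⟩
    have hcard : ∀ v ∈ C, (C.erase v).card = n := fun v hv => by
      rw [Finset.card_erase_of_mem hv, hn, Nat.add_sub_cancel]
    have hmono : ∀ v, hardCorePotential Ind r S (C.erase v) ≤ hardCorePotential Ind r S C :=
      fun v => hardCorePotential_mono hS (Finset.erase_subset v C) hr
    have herase : ∀ I v, v ∉ I → I ⊆ S ∪ C → I ⊆ S ∪ C.erase v := by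
      intro I v hv hI x hx
      have hxv : x ≠ v := fun h => hv (h ▸ hx)
      simpa [hxv] using hI hx
    by_cases hins : ∀ v ∈ C, Ind (insert v S)
    swap
    · push Not at hins
      obtain ⟨v, hv, hvS⟩ := hins
      obtain ⟨K, hK1, hK2, hK3⟩ := ih (C.erase v) (hcard v hv) S
      refine ⟨K, hK1.trans (Real.exp_le_exp.2 ?_), fun P hP => ⟨?_, (hK2 P hP).2⟩, ?_⟩
      · have := mul_le_mul_of_nonneg_left (hmono v) ha
        push_cast
        linarith
      · linarith [(hK2 P hP).1, hmono v]
      · intro I hI hSI hIC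
        refine hK3 I hI hSI (herase I v (fun hvI => hvS ?_) hIC)
        exact hInd _ _ (Finset.insert_subset hvI hSI) hI
    obtain ⟨v, hv, hdrop⟩ := exists_hardCorePotential_insert_le hS hins hr (not_le.1 hlarge)
    obtain ⟨K, hK1, hK2, hK3⟩ := ih (C.erase v) (hcard v hv) S
    obtain ⟨K', hK1', hK2', hK3'⟩ := ih (C.erase v) (hcard v hv) (insert v S)
    refine ⟨K ∪ K', ?_, fun P hP => ?_, ?_⟩
    · have h1 : ((K ∪ K').card : ℝ) ≤ K.card + K'.card := by
        exact_mod_cast Finset.card_union_le K K'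
      have h2 : (K.card : ℝ) ≤ Real.exp (a * hardCorePotential Ind r S C + b * n) :=
        hK1.trans (Real.exp_le_exp.2 (by linarith [mul_le_mul_of_nonneg_left (hmono v) ha]))
      have h3 : (K'.card : ℝ) ≤ Real.exp (a * hardCorePotential Ind r S C + b * n) *
          Real.exp (-(a * (β * r))) := by
        rw [← Real.exp_add]
        exact hK1'.trans (Real.exp_le_exp.2
          (by linarith [mul_le_mul_of_nonneg_left hdrop ha]))
      have h4 := mul_le_mul_of_nonneg_left hab
        (Real.exp_pos (a * hardCorePotential Ind r S C + b * n)).le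
      rw [← Real.exp_add (a * hardCorePotential Ind r S C + b * n) b] at h4
      push_cast
      have h5 : a * hardCorePotential Ind r S C + b * n + b =
        a * hardCorePotential Ind r S C + b * (n + 1) := by ring
      rw [← h5]
      linarith
    · rcases Finset.mem_union.1 hP with hP | hP
      · exact ⟨by linarith [(hK2 P hP).1, hmono v], (hK2 P hP).2⟩
      · refine ⟨?_, (hK2' P hP).2⟩
        have h1 := (hK2' P hP).1
        have h2 : ((insert v S).card : ℝ) ≤ S.card + 1 := by
          exact_mod_cast Finset.card_insert_le v S
        have h3 := mul_le_mul_of_nonneg_right h2 (mul_nonneg hβ hr)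
        linarith
    · intro I hI hSI hIC
      by_cases hvI : v ∈ I
      · obtain ⟨P, hP, hPI⟩ := hK3' I hI (Finset.insert_subset hvI hSI) fun x hx => by
          have := hIC hx
          by_cases hxv : x = v <;> simp_all
        exact ⟨P, Finset.mem_union_right _ hP, hPI⟩
      · obtain ⟨P, hP, hPI⟩ := hK3 I hI hSI (herase I v hvI hIC)
        exact ⟨P, Finset.mem_union_left _ hP, hPI⟩

end Container

section Regularization

variable {V : Type*}

lemma eMass_indHG {H : Finset (Finset V)} {W : Finset V} {ν : Finset V → ℝ}
    (hν : IsMeasureOn (indHG H W) ν) : eMass (indHG H W) ν = eMass H ν :=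
  Finset.sum_subset (Finset.filter_subset _ _) fun E _ hE => hν.2 E hE

lemma dMass_indHG {H : Finset (Finset V)} {W : Finset V} {ν : Finset V → ℝ}
    (hν : IsMeasureOn (indHG H W) ν) (L : Finset V) : dMass (indHG H W) ν L = dMass H ν L := by
  unfold dMass
  rw [Finset.sum_filter, Finset.sum_filter]
  refine Finset.sum_subset (Finset.filter_subset _ _) fun E _ hE => ?_
  rw [hν.2 E hE, ite_self]

lemma lamP_indHG [Fintype V] {H : Finset (Finset V)} {W : Finset V} {ν : Finset V → ℝ}
    (hν : IsMeasureOn (indHG H W) ν) (p : ℝ) : lamP p (indHG H W) ν = lamP p H ν := by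
  simp only [lamP, dMass_indHG hν]

lemma dMass_nonneg {H : Finset (Finset V)} {ν : Finset V → ℝ} (hν : ∀ E, 0 ≤ ν E)
    (L : Finset V) : 0 ≤ dMass H ν L := Finset.sum_nonneg fun E _ => hν E

lemma dMass_le_eMass {H : Finset (Finset V)} {ν : Finset V → ℝ} (hν : ∀ E, 0 ≤ ν E)
    (L : Finset V) : dMass H ν L ≤ eMass H ν :=
  Finset.sum_le_sum_of_subset_of_nonneg (Finset.filter_subset _ _) fun E _ _ => hν E

lemma lamP_nonneg [Fintype V] {p : ℝ} (hp : 0 ≤ p) (H : Finset (Finset V))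
    (ν : Finset V → ℝ) : 0 ≤ lamP p H ν :=
  Finset.sum_nonneg fun _ _ => by positivity

lemma dMass_add (H : Finset (Finset V)) (ν ν' : Finset V → ℝ) (L : Finset V) :
    dMass H (fun E => ν E + ν' E) L = dMass H ν L + dMass H ν' L :=
  Finset.sum_add_distrib

lemma dMass_div (H : Finset (Finset V)) (ν : Finset V → ℝ) (c : ℝ) (L : Finset V) :
    dMass H (fun E => ν E / c) L = dMass H ν L / c := (Finset.sum_div _ _ _).symm

lemma sum_dMass_singleton [Fintype V] (H : Finset (Finset V)) (ν : Finset V → ℝ) :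
    ∑ v, dMass H ν {v} = ∑ E ∈ H, E.card * ν E := by
  simp only [dMass, Finset.singleton_subset_iff, Finset.sum_filter]
  rw [Finset.sum_comm]
  refine Finset.sum_congr rfl fun E _ => ?_
  rw [← Finset.sum_filter, Finset.sum_const, nsmul_eq_mul]
  congr 3
  ext v
  simp

lemma lamP_add_le [Fintype V] {p : ℝ} (hp : 0 ≤ p) (H : Finset (Finset V))
    (ν ν' : Finset V → ℝ) {N : ℝ} (hN : 0 < N) :
    lamP p H (fun E => ν E + ν' E) ≤ (1 + 1 / N) * lamP p H ν + (1 + N) * lamP p H ν' := by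
  unfold lamP
  rw [Finset.mul_sum, Finset.mul_sum, ← Finset.sum_add_distrib]
  refine Finset.sum_le_sum fun L _ => ?_
  rw [dMass_add, ← mul_div_assoc, ← mul_div_assoc, ← add_div]
  refine div_le_div_of_nonneg_right ?_ (by positivity)
  have h : (1 + 1 / N) * dMass H ν L ^ 2 + (1 + N) * dMass H ν' L ^ 2 -
      (dMass H ν L + dMass H ν' L) ^ 2 = (dMass H ν L - N * dMass H ν' L) ^ 2 / N := by
    field_simp
    ring
  have : 0 ≤ (dMass H ν L - N * dMass H ν' L) ^ 2 / N := by positivity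
  linarith

lemma IsJanson.exists_eMass_eq_one [Fintype V] {p R : ℝ} (hp : 0 ≤ p) (hR : 0 < R)
    {H : Finset (Finset V)} {W : Finset V} (hJ : IsJanson p R (indHG H W)) :
    ∃ ν, IsMeasureOn (indHG H W) ν ∧ eMass H ν = 1 ∧ lamP p H ν ≤ 1 / R := by
  obtain ⟨ν, hν, hlam⟩ := hJ hR
  rw [eMass_indHG hν, lamP_indHG hν] at hlam
  have h0 : eMass H ν ≠ 0 := fun h => by
    have := lamP_nonneg hp H ν
    rw [h] at hlam
    simp only [ne_eq, OfNat.ofNat_ne_zero, not_false_eq_true, zero_pow, zero_div] at hlam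
    linarith
  have hpos : 0 < eMass H ν :=
    lt_of_le_of_ne (Finset.sum_nonneg fun E _ => hν.1 E) h0.symm
  refine ⟨fun E => ν E / eMass H ν, ⟨fun E => div_nonneg (hν.1 E) hpos.le,
    fun E hE => by dsimp only; rw [hν.2 E hE, zero_div]⟩, ?_, ?_⟩
  · unfold eMass
    rw [← Finset.sum_div]
    exact div_self h0
  · have : lamP p H (fun E => ν E / eMass H ν) = lamP p H ν / eMass H ν ^ 2 := by
      unfold lamP
      rw [Finset.sum_div]
      refine Finset.sum_congr rfl fun L _ => ?_
      rw [dMass_div]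
      ring
    rw [this, div_le_div_iff₀ (by positivity) hR, one_mul]
    rw [lt_div_iff₀ hR] at hlam
    exact hlam.le

/-- If a uniform hypergraph is Janson on every large set, then every slightly larger set carries
a measure with small `Λ_p` and bounded degrees. -/
lemma exists_bounded_degree_measure [Fintype V] {p R M : ℝ} (hp : 0 ≤ p) (hR : 0 < R)
    {s k : ℕ} (hsk : s ≤ k) (hk : 0 < k) {H : Finset (Finset V)} (hcard : ∀ E ∈ H, E.card = s)
    (hJ : ∀ W : Finset V, M / 16 ≤ (W.card : ℝ) → IsJanson p R (indHG H W))
    {W : Finset V} (hW : 3 * M / 32 ≤ (W.card : ℝ)) (n : ℕ) (hn : (n : ℝ) + 1 ≤ M) :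
    ∃ ν, IsMeasureOn (indHG H W) ν ∧ eMass H ν = n + 1 ∧ lamP p H ν ≤ (n + 1) ^ 2 / R ∧
      ∀ v, dMass H ν {v} ≤ 32 * k + 1 := by
  have hk' : (1 : ℝ) ≤ k := by exact_mod_cast hk
  induction n with
  | zero =>
    obtain ⟨ν, hν, he, hlam⟩ := (hJ W (by linarith)).exists_eMass_eq_one hp hR
    refine ⟨ν, hν, by simpa using he, by simpa using hlam, fun v => ?_⟩
    have := dMass_le_eMass (H := H) hν.1 {v}
    linarith
  | succ n ih =>
    push_cast at hn
    obtain ⟨ν, hν, he, hlam, hdeg⟩ := ih (by linarith)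
    set bad : Finset V := Finset.univ.filter fun v => 32 * (k : ℝ) ≤ dMass H ν {v} with hbad
    have hbadcard : (bad.card : ℝ) ≤ M / 32 := by
      have h1 : (bad.card : ℝ) * (32 * k) ≤ ∑ v, dMass H ν {v} := by
        rw [← nsmul_eq_mul]
        refine (Finset.card_nsmul_le_sum bad _ _ fun v hv => (Finset.mem_filter.1 hv).2).trans ?_
        exact Finset.sum_le_sum_of_subset_of_nonneg (Finset.subset_univ _)
          fun v _ _ => dMass_nonneg hν.1 _
      have h2 : ∑ E ∈ H, (E.card : ℝ) * ν E = s * eMass H ν := by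
        unfold eMass
        rw [Finset.mul_sum]
        exact Finset.sum_congr rfl fun E hE => by rw [hcard E hE]
      rw [sum_dMass_singleton, h2, he] at h1
      have h3 : (s : ℝ) ≤ k := by exact_mod_cast hsk
      have h4 : (s : ℝ) * (n + 1) ≤ k * M :=
        mul_le_mul h3 (by linarith) (by positivity) (by positivity)
      have h5 : (k : ℝ) * (bad.card * 32) ≤ k * M := by linarith
      have := le_of_mul_le_mul_left h5 (by linarith)
      linarith
    have hW' : M / 16 ≤ ((W \ bad).card : ℝ) := by
      have : (W.card : ℝ) ≤ (W \ bad).card + bad.card := by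
        exact_mod_cast Finset.card_le_card_sdiff_add_card
      linarith
    obtain ⟨ν', hν', he', hlam'⟩ := (hJ _ hW').exists_eMass_eq_one hp hR
    refine ⟨fun E => ν E + ν' E, ⟨fun E => add_nonneg (hν.1 E) (hν'.1 E), fun E hE => ?_⟩,
      ?_, ?_, fun v => ?_⟩
    · dsimp only
      rw [hν.2 E hE, hν'.2 E, add_zero]
      intro hE'
      simp only [indHG, Finset.mem_filter] at hE hE'
      exact hE ⟨hE'.1, hE'.2.trans Finset.sdiff_subset⟩
    · have : eMass H (fun E => ν E + ν' E) = eMass H ν + eMass H ν' := Finset.sum_add_distrib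
      rw [this, he, he']
      push_cast
      ring
    · have hN : (0 : ℝ) < n + 1 := by positivity
      refine (lamP_add_le hp H ν ν' hN).trans ?_
      have h1 := mul_le_mul_of_nonneg_left hlam (by positivity : (0 : ℝ) ≤ 1 + 1 / (n + 1))
      have h2 := mul_le_mul_of_nonneg_left hlam' (by positivity : (0 : ℝ) ≤ 1 + (n + 1))
      refine (add_le_add h1 h2).trans (le_of_eq ?_)
      push_cast
      field_simp
      ring
    · rw [dMass_add]
      by_cases hv : v ∈ bad
      · have : dMass H ν' {v} = 0 := by
          refine Finset.sum_eq_zero fun E hE => hν'.2 E fun hE' => ?_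
          simp only [indHG, Finset.mem_filter, Finset.singleton_subset_iff] at hE hE'
          exact (Finset.mem_sdiff.1 (hE'.2 hE.2)).2 hv
        rw [this, add_zero]
        exact hdeg v
      · have h1 : dMass H ν {v} < 32 * k := by
          simpa [hbad] using hv
        have h2 := dMass_le_eMass (H := H) hν'.1 {v}
        linarith

lemma sum_inter_le_lamP [Fintype V] [DecidableEq V] {p : ℝ} (hp : 0 ≤ p) (H : Finset (Finset V))
    {ν : Finset V → ℝ} (hν : ∀ E, 0 ≤ ν E) :
    ∑ E ∈ H, ν E * ∑ E' ∈ H with (E ∩ E').Nonempty, ν E' / p ^ (E ∩ E').card ≤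
      lamP p H ν + ∑ v, dMass H ν {v} ^ 2 / p := by
  have h1 : ∀ E ∈ H, ν E * ∑ E' ∈ H with (E ∩ E').Nonempty, ν E' / p ^ (E ∩ E').card ≤
      ∑ E' ∈ H, ∑ L : Finset V with L.Nonempty,
        (if L ⊆ E then ν E else 0) * (if L ⊆ E' then ν E' else 0) / p ^ L.card := by
    intro E _
    rw [Finset.mul_sum, Finset.sum_filter]
    refine Finset.sum_le_sum fun E' _ => ?_
    have hterm : ∀ L : Finset V,
        0 ≤ (if L ⊆ E then ν E else 0) * (if L ⊆ E' then ν E' else 0) / p ^ L.card := by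
      intro L
      have := hν E
      have := hν E'
      split_ifs <;> positivity
    split_ifs with hne
    · refine le_trans (le_of_eq ?_) (Finset.single_le_sum (fun L _ => hterm L)
        (Finset.mem_filter.2 ⟨Finset.mem_univ (E ∩ E'), hne⟩))
      rw [if_pos Finset.inter_subset_left, if_pos Finset.inter_subset_right, mul_div_assoc]
    · exact Finset.sum_nonneg fun L _ => hterm L
  have h2 : ∑ E ∈ H, ∑ E' ∈ H, ∑ L : Finset V with L.Nonempty,
        (if L ⊆ E then ν E else 0) * (if L ⊆ E' then ν E' else 0) / p ^ L.card =
      ∑ L : Finset V with L.Nonempty, dMass H ν L ^ 2 / p ^ L.card := by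
    simp_rw [Finset.sum_comm (s := H) (t := Finset.univ.filter fun L : Finset V => L.Nonempty)]
    refine Finset.sum_congr rfl fun L _ => ?_
    simp_rw [← Finset.sum_div]
    rw [← Finset.sum_mul_sum, ← Finset.sum_filter, pow_two, dMass]
    congr!
  refine (Finset.sum_le_sum h1).trans (h2.le.trans (le_of_eq ?_))
  have h3 : (Finset.univ.filter fun L : Finset V => L.Nonempty) =
      (Finset.univ.filter fun L : Finset V => 2 ≤ L.card) ∪
        Finset.univ.image fun v : V => ({v} : Finset V) := by
    ext L
    simp only [Finset.mem_filter, Finset.mem_univ, true_and, Finset.mem_union, Finset.mem_image]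
    rw [← Finset.card_pos]
    have : (∃ a, {a} = L) ↔ L.card = 1 := by
      rw [Finset.card_eq_one]
      exact exists_congr fun a => eq_comm
    rw [this]
    omega
  rw [h3, Finset.sum_union, Finset.sum_image]
  · simp [lamP]
  · intro a _ b _ h
    simpa using h
  · rw [Finset.disjoint_left]
    intro L hL hL'
    simp only [Finset.mem_filter, Finset.mem_image, Finset.mem_univ, true_and] at hL hL'
    obtain ⟨v, rfl⟩ := hL'
    simp at hL

end Regularization

section Copies

lemma extendGraph_adj_some_some {V : Type*} (G : SimpleGraph V) (A : Finset V) (x y : V) :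
    (extendGraph G A).Adj (some x) (some y) ↔ G.Adj x y := by
  simp only [extendGraph, SimpleGraph.fromRel_adj, ne_eq, Option.some.injEq]
  exact ⟨fun h => h.2.elim id fun h' => h'.symm, fun h => ⟨h.ne, Or.inl h⟩⟩

lemma extendGraph_adj_some_none {V : Type*} (G : SimpleGraph V) (A : Finset V) (x : V) :
    (extendGraph G A).Adj (some x) none ↔ x ∈ A := by
  simp [extendGraph, SimpleGraph.fromRel_adj]

lemma extendGraph_adj_none_some {V : Type*} (G : SimpleGraph V) (A : Finset V) (x : V) :
    (extendGraph G A).Adj none (some x) ↔ x ∈ A := by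
  rw [SimpleGraph.adj_comm, extendGraph_adj_some_none]

lemma mem_copyHG {W V : Type*} [Fintype V] {F : SimpleGraph W} {G' G : SimpleGraph V}
    {L : Finset V} : L ∈ copyHG F G' G ↔ (∀ x ∈ L, ∀ y ∈ L, G'.Adj x y ↔ G.Adj x y) ∧
      Nonempty (F ≃g G.induce (L : Set V)) := by
  simp [copyHG]

lemma card_eq_of_mem_copyHG {W V : Type*} [Fintype W] [Fintype V] {F : SimpleGraph W}
    {G' G : SimpleGraph V} {L : Finset V} (hL : L ∈ copyHG F G' G) :
    L.card = Fintype.card W := by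
  obtain ⟨φ⟩ := (mem_copyHG.1 hL).2
  have := Fintype.card_congr φ.toEquiv
  simpa using this.symm

/-- An isomorphism from `F - w` onto `G[L]` extends to an isomorphism from `F`. -/
lemma nonempty_iso_extendGraph {W V : Type*} {F : SimpleGraph W} {w : W} {G : SimpleGraph V}
    {L A : Finset V} (φ : F.induce ({w}ᶜ : Set W) ≃g G.induce (L : Set V))
    (hA : ∀ x, (φ x : V) ∈ A ↔ F.Adj w x) :
    Nonempty (F ≃g (extendGraph G A).induce (Finset.insertNone L : Set (Option V))) := by
  obtain ⟨f, hfw, hfx⟩ : ∃ f : W → Option V, f w = none ∧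
      ∀ x (h : x ≠ w), f x = some (φ ⟨x, h⟩ : V) :=
    ⟨fun x => if h : x = w then none else some (φ ⟨x, h⟩ : V), dif_pos rfl,
      fun x h => dif_neg h⟩
  have hmem : ∀ x, f x ∈ (Finset.insertNone L : Set (Option V)) := by
    intro x
    by_cases hx : x = w
    · rw [hx, hfw]
      exact Finset.none_mem_insertNone
    · rw [hfx x hx]
      exact Finset.some_mem_insertNone.2 (φ ⟨x, hx⟩).2
  have hinj : ∀ x y, f x = f y → x = y := by
    intro x y hxy
    by_cases hx : x = w <;> by_cases hy : y = w
    · rw [hx, hy]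
    · rw [hx, hfw, hfx y hy] at hxy
      exact absurd hxy.symm (Option.some_ne_none _)
    · rw [hy, hfw, hfx x hx] at hxy
      exact absurd hxy (Option.some_ne_none _)
    · rw [hfx x hx, hfx y hy, Option.some_inj] at hxy
      exact congrArg Subtype.val (φ.injective (Subtype.ext hxy))
  have hsurj : ∀ o ∈ Finset.insertNone L, ∃ x, f x = o := by
    intro o ho
    rcases o with _ | u
    · exact ⟨w, hfw⟩
    · obtain ⟨x, hx⟩ := φ.surjective ⟨u, Finset.some_mem_insertNone.1 ho⟩
      exact ⟨x, by rw [hfx x x.2, Subtype.coe_eta, hx]⟩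
  have hadj : ∀ x y, (extendGraph G A).Adj (f x) (f y) ↔ F.Adj x y := by
    intro x y
    by_cases hx : x = w <;> by_cases hy : y = w
    · rw [hx, hy]
      exact iff_of_false (SimpleGraph.irrefl _) (SimpleGraph.irrefl _)
    · rw [hx, hfw, hfx y hy, extendGraph_adj_none_some]
      exact hA ⟨y, hy⟩
    · rw [hy, hfw, hfx x hx, extendGraph_adj_some_none, F.adj_comm]
      exact hA ⟨x, hx⟩
    · rw [hfx x hx, hfx y hy, extendGraph_adj_some_some]
      exact φ.map_rel_iff (a := ⟨x, hx⟩) (b := ⟨y, hy⟩)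
  exact ⟨⟨Equiv.ofBijective (fun x => ⟨f x, hmem x⟩)
    ⟨fun x y h => hinj x y (congrArg Subtype.val h), fun o =>
      (hsurj o.1 o.2).imp fun x hx => Subtype.ext hx⟩, fun {x y} => hadj x y⟩⟩

/-- Every copy of `F - w` can be tagged so that it extends to a copy of `F` whenever the
neighbourhood of the new vertex agrees with the tags. -/
lemma exists_tag {W V : Type*} [Fintype V] (F : SimpleGraph W) (w : W) (G' G : SimpleGraph V)
    (L : Finset V) : ∃ c : V → Bool, L ∈ copyHG (F.induce ({w}ᶜ : Set W)) G' G →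
      ∀ A B : Finset V, B ⊆ A → (∀ u ∈ L, if c u then u ∈ B else u ∉ A) →
        (copyHG F (extendGraph G' B) (extendGraph G A)).Nonempty := by
  by_cases hL : L ∈ copyHG (F.induce ({w}ᶜ : Set W)) G' G
  swap
  · exact ⟨fun _ => true, fun h => absurd h hL⟩
  obtain ⟨hadj, ⟨φ⟩⟩ := mem_copyHG.1 hL
  refine ⟨fun u => decide (∃ x : ({w}ᶜ : Set W), F.Adj w x ∧ (φ x : V) = u),
    fun _ A B hBA hc => ?_⟩
  have hiff : ∀ x : ({w}ᶜ : Set W), ((φ x : V) ∈ A ↔ F.Adj w x) ∧ ((φ x : V) ∈ B ↔ F.Adj w x) := by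
    intro x
    have h := hc (φ x) (φ x).2
    by_cases hx : F.Adj w x
    · rw [if_pos (decide_eq_true ⟨x, hx, rfl⟩)] at h
      simp [hx, h, hBA h]
    · rw [if_neg] at h
      · exact ⟨iff_of_false h hx, iff_of_false (fun h' => h (hBA h')) hx⟩
      · simp only [decide_eq_true_eq]
        rintro ⟨y, hy, hyx⟩
        exact hx (φ.injective (Subtype.ext hyx) ▸ hy)
  have hiffL : ∀ u ∈ L, u ∈ B ↔ u ∈ A := by
    intro u hu
    obtain ⟨x, hx⟩ := φ.surjective ⟨u, hu⟩
    have := hiff x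
    rw [hx] at this
    exact this.2.trans this.1.symm
  refine ⟨Finset.insertNone L, mem_copyHG.2 ⟨?_, ?_⟩⟩
  · rintro (_ | x) hx (_ | y) hy
    · exact iff_of_false (SimpleGraph.irrefl _) (SimpleGraph.irrefl _)
    · rw [extendGraph_adj_none_some, extendGraph_adj_none_some]
      exact hiffL y (Finset.some_mem_insertNone.1 hy)
    · rw [extendGraph_adj_some_none, extendGraph_adj_some_none]
      exact hiffL x (Finset.some_mem_insertNone.1 hx)
    · rw [extendGraph_adj_some_some, extendGraph_adj_some_some]
      exact hadj x (Finset.some_mem_insertNone.1 hx) y (Finset.some_mem_insertNone.1 hy)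
  · exact nonempty_iso_extendGraph φ fun x => (hiff x).1

end Copies

section Tags

lemma mem_indHG {V : Type*} {H : Finset (Finset V)} {X E : Finset V} :
    E ∈ indHG H X ↔ E ∈ H ∧ E ⊆ X := by
  simp [indHG]

variable {U : Type*} [DecidableEq U]

/-- The set `L` with each of its elements `u` marked by the tag `c L u`. -/
def tagEdge (c : Finset U → U → Bool) (L : Finset U) : Finset (U × Bool) :=
  L.image fun u => (u, c L u)

/-- The property of containing no tagged edge of `H`. -/
def TagFree (H : Finset (Finset U)) (c : Finset U → U → Bool) (T : Finset (U × Bool)) : Prop :=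
  ∀ L ∈ H, ¬ tagEdge c L ⊆ T

lemma TagFree.mono {H : Finset (Finset U)} {c : Finset U → U → Bool} (A B : Finset (U × Bool))
    (hAB : A ⊆ B) (hB : TagFree H c B) : TagFree H c A :=
  fun L hL h => hB L hL (h.trans hAB)

lemma mem_tagEdge {c : Finset U → U → Bool} {L : Finset U} {x : U × Bool} :
    x ∈ tagEdge c L ↔ x.1 ∈ L ∧ c L x.1 = x.2 := by
  obtain ⟨u, b⟩ := x
  simp only [tagEdge, Finset.mem_image, Prod.mk.injEq]
  constructor
  · rintro ⟨a, ha, rfl, rfl⟩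
    exact ⟨ha, rfl⟩
  · rintro ⟨hu, rfl⟩
    exact ⟨u, hu, rfl, rfl⟩

lemma card_tagEdge_inter_le (c : Finset U → U → Bool) (L L' : Finset U) :
    (tagEdge c L ∩ tagEdge c L').card ≤ (L ∩ L').card := by
  refine Finset.card_le_card_of_injOn Prod.fst (fun x hx => ?_) fun x hx y hy hxy => ?_
  · have hx := Finset.mem_inter.1 hx
    exact Finset.mem_inter.2 ⟨(mem_tagEdge.1 hx.1).1, (mem_tagEdge.1 hx.2).1⟩
  · have hx := (mem_tagEdge.1 (Finset.mem_inter.1 hx).1).2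
    have hy := (mem_tagEdge.1 (Finset.mem_inter.1 hy).1).2
    refine Prod.ext hxy ?_
    rw [← hx, ← hy, hxy]

/-- Janson's inequality for the tagged copies of the edges of `H`. -/
lemma hardCoreSum_tagFree_le [Fintype U] {H : Finset (Finset U)} (c : Finset U → U → Bool)
    {W : Finset U} {C : Finset (U × Bool)} (hC : ∀ u ∈ W, ∀ b, (u, b) ∈ C)
    {r p : ℝ} (hr : 0 < r) (hp : p = r / (1 + r)) {ν : Finset U → ℝ}
    (hν : IsMeasureOn (indHG H W) ν) {t : ℝ} (ht : 0 ≤ t) :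
    hardCoreSum (TagFree H c) ∅ C r ≤ (1 + r) ^ C.card *
      Real.exp (-t * eMass H ν + t ^ 2 / 2 * (lamP p H ν + ∑ v, dMass H ν {v} ^ 2 / p)) := by
  have hp0 : 0 < p := by rw [hp]; positivity
  have hp1 : p ≤ 1 := by rw [hp, div_le_one (by positivity)]; linarith
  have hsub : indHG H W ⊆ H := fun L hL => (mem_indHG.1 hL).1
  have hE : ∀ L ∈ indHG H W, tagEdge c L ⊆ C := by
    intro L hL x hx
    exact hC x.1 ((mem_indHG.1 hL).2 (mem_tagEdge.1 hx).1) x.2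
  have hmass : ∑ L ∈ indHG H W, ν L = eMass H ν :=
    Finset.sum_subset hsub fun L _ hL => hν.2 L hL
  have hpair : ∑ L ∈ indHG H W, ν L * ∑ L' ∈ indHG H W with
        (tagEdge c L ∩ tagEdge c L').Nonempty, ν L' / p ^ (tagEdge c L ∩ tagEdge c L').card ≤
      lamP p H ν + ∑ v, dMass H ν {v} ^ 2 / p := by
    refine le_trans ?_ (sum_inter_le_lamP hp0.le H hν.1)
    have hterm : ∀ L L' : Finset U, 0 ≤ ν L' / p ^ (L ∩ L').card := fun L L' =>
      div_nonneg (hν.1 L') (by positivity)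
    refine (Finset.sum_le_sum fun L _ => mul_le_mul_of_nonneg_left ?_ (hν.1 L)).trans
      (Finset.sum_le_sum_of_subset_of_nonneg hsub fun L _ _ =>
        mul_nonneg (hν.1 L) (Finset.sum_nonneg fun L' _ => hterm L L'))
    refine (Finset.sum_le_sum fun L' _ => ?_).trans
      (Finset.sum_le_sum_of_subset_of_nonneg (fun L' hL' => ?_) fun L' _ _ => hterm L L')
    · exact div_le_div_of_nonneg_left (hν.1 L') (by positivity)
        (pow_le_pow_of_le_one hp0.le hp1 (card_tagEdge_inter_le c L L'))
    · obtain ⟨hL', hne⟩ := Finset.mem_filter.1 hL'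
      refine Finset.mem_filter.2 ⟨hsub hL', Finset.card_pos.1 ?_⟩
      exact (Finset.card_pos.2 hne).trans_le (card_tagEdge_inter_le c L L')
  have hjanson := sum_pow_card_le_janson hr hE hν.1 ht hp
  rw [hmass] at hjanson
  refine le_trans ?_ (hjanson.trans (mul_le_mul_of_nonneg_left (Real.exp_le_exp.2 (add_le_add
    le_rfl (mul_le_mul_of_nonneg_left hpair (by positivity)))) (by positivity)))
  refine Finset.sum_le_sum_of_subset_of_nonneg (fun T hT => ?_) fun _ _ _ => by positivity
  rw [Finset.mem_filter, Finset.union_empty] at hT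
  simp only [Finset.mem_filter]
  exact ⟨hT.1, fun L hL => hT.2 L (hsub hL)⟩

/-- A set of tagged vertices with many doubly tagged vertices has a small hard-core sum. -/
lemma hardCoreSum_tagFree_lt [Fintype U] {H : Finset (Finset U)} (c : Finset U → U → Bool)
    {s k m : ℕ} (hsk : s ≤ k) (hk : 0 < k) (hm : 0 < m) (hcardU : Fintype.card U = m)
    (hcard : ∀ E ∈ H, E.card = s) {p r : ℝ} (hp : p = 1 / (2 ^ 20 * (k : ℝ) ^ 2))
    (hr : r = p / (1 - p))
    (hJ : ∀ W : Finset U, (m : ℝ) / 16 ≤ (W.card : ℝ) → IsJanson p (p * m / 2 ^ 5) (indHG H W))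
    {C : Finset (U × Bool)}
    (hC : 3 * (m : ℝ) / 32 ≤
      ((Finset.univ.filter fun u => (u, true) ∈ C ∧ (u, false) ∈ C).card : ℝ)) :
    hardCoreSum (TagFree H c) ∅ C r <
      Real.exp ((1 - 1 / (2 ^ 9 * (k : ℝ) ^ 2)) * r * C.card) := by
  have hk1 : (1 : ℝ) ≤ k := by exact_mod_cast hk
  have hm0 : (0 : ℝ) < m := by exact_mod_cast hm
  have hk2 : (1 : ℝ) ≤ (k : ℝ) ^ 2 := one_le_pow₀ hk1
  have hp0 : 0 < p := by rw [hp]; positivity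
  have hp1 : p ≤ 1 / 2 ^ 20 := by
    rw [hp]
    exact one_div_le_one_div_of_le (by positivity) (by linarith)
  have hq : 0 < 1 - p := by linarith
  have hr0 : 0 < r := by rw [hr]; positivity
  have hrp : r ≤ 1.01 * p := by
    rw [hr, div_le_iff₀ hq]
    nlinarith
  have hpr : p = r / (1 + r) := by
    rw [hr]
    field_simp
    ring
  obtain ⟨n, rfl⟩ : ∃ n, m = n + 1 := ⟨m - 1, by omega⟩
  obtain ⟨ν, hν, he, hlam, hdeg⟩ := exists_bounded_degree_measure hp0.le
    (by positivity : 0 < p * ((n + 1 : ℕ) : ℝ) / 2 ^ 5) hsk hk hcard hJ hC n (by push_cast; rfl)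
  generalize hM : ((n + 1 : ℕ) : ℝ) = M at *
  have hM' : (n : ℝ) + 1 = M := by rw [← hM]; push_cast; rfl
  rw [hM'] at he hlam
  have hdegsum : ∑ v, dMass H ν {v} ^ 2 / p ≤ 33 * (k : ℝ) ^ 2 * M / p := by
    have h1 : ∑ v, dMass H ν {v} = s * M := by
      rw [sum_dMass_singleton, ← he, eMass, Finset.mul_sum]
      exact Finset.sum_congr rfl fun E hE => by rw [hcard E hE]
    have h2 : ∑ v, dMass H ν {v} ^ 2 ≤ 33 * k * ∑ v, dMass H ν {v} := by
      rw [Finset.mul_sum]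
      refine Finset.sum_le_sum fun v _ => ?_
      rw [pow_two]
      exact mul_le_mul_of_nonneg_right ((hdeg v).trans (by linarith)) (dMass_nonneg hν.1 _)
    have h3 : (s : ℝ) * M ≤ k * M :=
      mul_le_mul_of_nonneg_right (by exact_mod_cast hsk) hm0.le
    rw [← Finset.sum_div]
    refine div_le_div_of_nonneg_right ?_ hp0.le
    rw [h1] at h2
    nlinarith
  have hQ : lamP p H ν + ∑ v, dMass H ν {v} ^ 2 / p ≤ 65 * (k : ℝ) ^ 2 * M / p := by
    have h1 : M ^ 2 / (p * M / 2 ^ 5) = 32 * M / p := by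
      field_simp
      norm_num
    have h2 : 32 * M / p ≤ 32 * (k : ℝ) ^ 2 * M / p :=
      div_le_div_of_nonneg_right (by nlinarith) hp0.le
    have h3 : 65 * (k : ℝ) ^ 2 * M / p = 32 * (k : ℝ) ^ 2 * M / p + 33 * (k : ℝ) ^ 2 * M / p := by
      ring
    linarith
  have hcardC : (C.card : ℝ) ≤ 2 * M := by
    have := Finset.card_le_univ C
    rw [Fintype.card_prod, hcardU, Fintype.card_bool] at this
    rw [← hM]
    have h' : (C.card : ℝ) ≤ ((n + 1 : ℕ) : ℝ) * 2 := by exact_mod_cast this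
    linarith
  refine (hardCoreSum_tagFree_le c (W := Finset.univ.filter fun u => (u, true) ∈ C ∧ (u, false) ∈ C)
    (fun u hu b => ?_) hr0 hpr hν (t := p / (65 * (k : ℝ) ^ 2)) (by positivity)).trans_lt ?_
  · have hu := (Finset.mem_filter.1 hu).2
    cases b
    exacts [hu.2, hu.1]
  have hpow : (1 + r) ^ C.card ≤ Real.exp (r * C.card) := by
    rw [mul_comm, Real.exp_nat_mul]
    have := Real.add_one_le_exp r
    exact pow_le_pow_left₀ (by positivity) (by linarith) _
  have hexp : -(p / (65 * (k : ℝ) ^ 2)) * eMass H ν + (p / (65 * (k : ℝ) ^ 2)) ^ 2 / 2 *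
      (lamP p H ν + ∑ v, dMass H ν {v} ^ 2 / p) ≤ -(p * M / (130 * (k : ℝ) ^ 2)) := by
    have h1 := mul_le_mul_of_nonneg_left hQ
      (by positivity : 0 ≤ (p / (65 * (k : ℝ) ^ 2)) ^ 2 / 2)
    have h2 : (p / (65 * (k : ℝ) ^ 2)) ^ 2 / 2 * (65 * (k : ℝ) ^ 2 * M / p) =
        p * M / (130 * (k : ℝ) ^ 2) := by
      field_simp
      norm_num
    have h3 : -(p / (65 * (k : ℝ) ^ 2)) * M = -2 * (p * M / (130 * (k : ℝ) ^ 2)) := by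
      field_simp
      norm_num
    rw [he]
    linarith
  refine (mul_le_mul hpow (Real.exp_le_exp.2 hexp) (Real.exp_pos _).le
    (Real.exp_pos _).le).trans_lt ?_
  rw [← Real.exp_add]
  refine Real.exp_lt_exp.2 ?_
  have h1 : r * C.card ≤ 1.01 * p * (2 * M) :=
    mul_le_mul hrp hcardC (Nat.cast_nonneg _) (by positivity)
  have h2 : 1 / (2 ^ 9 * (k : ℝ) ^ 2) * (r * C.card) ≤
      1 / (2 ^ 9 * (k : ℝ) ^ 2) * (1.01 * p * (2 * M)) :=
    mul_le_mul_of_nonneg_left h1 (by positivity)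
  have h3 : 1 / (2 ^ 9 * (k : ℝ) ^ 2) * (1.01 * p * (2 * M)) < p * M / (130 * (k : ℝ) ^ 2) := by
    rw [one_div_mul_eq_div, div_lt_div_iff₀ (by positivity) (by positivity)]
    have : 0 < p * M * (k : ℝ) ^ 2 := by positivity
    nlinarith
  linarith

end Tags

section Counting

variable {U : Type*} [Fintype U] [DecidableEq U]

lemma card_supersets_le (D : Finset U) {x : ℝ} (hx : x ≤ D.card) :
    ((Finset.univ.filter fun A : Finset U => D ⊆ A).card : ℝ) ≤
      2 ^ Fintype.card U * Real.exp (-(Real.log 2 * x)) := by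
  have h1 : (Finset.univ.filter fun A : Finset U => D ⊆ A) = Finset.Icc D Finset.univ := by
    ext A
    simp
  have h2 : (2 : ℝ) ^ D.card = Real.exp (Real.log 2 * D.card) := by
    rw [mul_comm, Real.exp_nat_mul, Real.exp_log two_pos]
  have h3 : Real.log 2 * x ≤ Real.log 2 * D.card :=
    mul_le_mul_of_nonneg_left hx (Real.log_nonneg one_le_two)
  rw [h1, Finset.card_Icc_finset (Finset.subset_univ D), Finset.card_univ]
  push_cast
  rw [pow_sub₀ _ two_ne_zero (Finset.card_le_univ D), h2, ← Real.exp_neg]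
  gcongr

/-- A container with few doubly tagged vertices covers few pairs `(A, B)` with `B` large. -/
lemma card_filter_container_le (P Q : Finset (U × Bool)) {y z : ℝ}
    (hQ : ((Finset.univ.filter fun u => (u, true) ∈ Q ∧ (u, false) ∈ Q).card : ℝ) ≤ y)
    (hP : (P.card : ℝ) ≤ z) {x : ℝ} :
    ((Finset.univ.filter fun A : Finset U => (∀ u, (u, false) ∉ P ∪ Q → u ∈ A) ∧
        x ≤ ((Finset.univ.filter fun u => (u, true) ∈ P ∪ Q).card : ℝ)).card : ℝ) ≤
      2 ^ Fintype.card U * Real.exp (-(Real.log 2 * (x - y - z))) := by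
  by_cases hx : x ≤ ((Finset.univ.filter fun u => (u, true) ∈ P ∪ Q).card : ℝ)
  · have hsub : (Finset.univ.filter fun u => (u, true) ∈ P ∪ Q) ⊆
        ((Finset.univ.filter fun u => (u, true) ∈ Q ∧ (u, false) ∈ Q) ∪ P.image Prod.fst) ∪
          Finset.univ.filter fun u => (u, false) ∉ P ∪ Q := by
      intro u hu
      simp only [Finset.mem_filter, Finset.mem_univ, true_and, Finset.mem_union, Finset.mem_image,
        Prod.exists, exists_and_right, exists_eq_right] at hu ⊢
      by_cases h1 : (u, true) ∈ P
      · exact Or.inl (Or.inr ⟨_, h1⟩)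
      by_cases h2 : (u, false) ∈ P
      · exact Or.inl (Or.inr ⟨_, h2⟩)
      tauto
    have hcard := (Finset.card_le_card hsub).trans ((Finset.card_union_le _ _).trans
      (add_le_add_left ((Finset.card_union_le _ _).trans
        (add_le_add_right Finset.card_image_le _)) _))
    have hcard' : ((Finset.univ.filter fun u => (u, true) ∈ P ∪ Q).card : ℝ) ≤
        (Finset.univ.filter fun u => (u, true) ∈ Q ∧ (u, false) ∈ Q).card + P.card +
          (Finset.univ.filter fun u => (u, false) ∉ P ∪ Q).card := by exact_mod_cast hcard
    refine le_trans ?_ (card_supersets_le (Finset.univ.filter fun u => (u, false) ∉ P ∪ Q)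
      (by linarith))
    refine Nat.cast_le.2 (Finset.card_le_card fun A hA => ?_)
    refine Finset.mem_filter.2 ⟨Finset.mem_univ _, fun u hu => ?_⟩
    exact (Finset.mem_filter.1 hA).2.1 u (Finset.mem_filter.1 hu).2
  · have : (Finset.univ.filter fun A : Finset U => (∀ u, (u, false) ∉ P ∪ Q → u ∈ A) ∧
        x ≤ ((Finset.univ.filter fun u => (u, true) ∈ P ∪ Q).card : ℝ)) = ∅ :=
      Finset.filter_false_of_mem fun A _ h => hx h.2
    rw [this, Finset.card_empty, Nat.cast_zero]
    positivity

/-- The tagged set recording that `B` is the neighbourhood of the new vertex in the subgraph and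
`A` its neighbourhood in the graph. -/
def tagPair (B A : Finset U) : Finset (U × Bool) :=
  Finset.univ.filter fun x => if x.2 = true then x.1 ∈ B else x.1 ∉ A

lemma mem_tagPair_true {B A : Finset U} {u : U} : (u, true) ∈ tagPair B A ↔ u ∈ B := by
  simp [tagPair]

lemma mem_tagPair_false {B A : Finset U} {u : U} : (u, false) ∈ tagPair B A ↔ u ∉ A := by
  simp [tagPair]

lemma tagFree_tagPair {W : Type*} {F : SimpleGraph W} {w : W} {G' G : SimpleGraph U}
    {c : Finset U → U → Bool}
    (hc : ∀ L, L ∈ copyHG (F.induce ({w}ᶜ : Set W)) G' G →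
      ∀ A B : Finset U, B ⊆ A → (∀ u ∈ L, if c L u then u ∈ B else u ∉ A) →
        (copyHG F (extendGraph G' B) (extendGraph G A)).Nonempty)
    {A B : Finset U} (hBA : B ⊆ A)
    (hempty : copyHG F (extendGraph G' B) (extendGraph G A) = ∅) :
    TagFree (copyHG (F.induce ({w}ᶜ : Set W)) G' G) c (tagPair B A) := by
  intro L hL hsub
  refine (hc L hL A B hBA fun u hu => ?_).ne_empty hempty
  have h : (u, c L u) ∈ tagPair B A := hsub (mem_tagEdge.2 ⟨hu, rfl⟩)
  cases hcu : c L u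
  · rw [hcu, mem_tagPair_false] at h
    simpa using h
  · rw [hcu, mem_tagPair_true] at h
    simpa using h

end Counting

/-- The numerical trade-off between the number of containers and their sizes. -/
lemma container_exponent_le {M : ℝ} (hM : 0 ≤ M) :
    Real.log 512 * (1.01 * M / 2 ^ 10) + 2 * M / 512 -
      Real.log 2 * (M / 8 - 3 * M / 32 - 1.01 * M / 2 ^ 10) ≤ -M / 2 ^ 7 := by
  have h1 : Real.log 512 = 9 * Real.log 2 := by
    rw [show (512 : ℝ) = 2 ^ 9 by norm_num, Real.log_pow]
    norm_num
  have h2 := Real.log_two_gt_d9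
  rw [h1]
  nlinarith

/-- **Lemma 3.1 (weak extension lemma, counting form).** With `p = 2^{-20}k^{-2}`: if
`ℑ_{F⁻,G̃',G̃}[W]` is `(p, 2^{-5}pm)`-Janson for every `W` with `|W| ≥ m/16`, then the number
of sets `A ⊆ U` admitting `B ⊆ A` with `|B| ≥ m/8` such that `ℑ_{F, G̃'⊕_v B, G̃⊕_v A}` has no
edges is at most `2·exp(-2^{-7}m)·2^m`. -/
theorem weak_extension_lemma (m s k : ℕ) (hsk : s < k) (hkm : k ≤ m)
    (F : SimpleGraph (Fin (s + 1))) (w : Fin (s + 1))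
    (G' G : SimpleGraph (Fin m)) (hGG : G' ≤ G)
    (hJanson : ∀ W : Finset (Fin m), (m : ℝ) / 16 ≤ (W.card : ℝ) →
      IsJanson (1 / (2 ^ 20 * (k : ℝ) ^ 2))
        ((1 / (2 ^ 20 * (k : ℝ) ^ 2)) * (m : ℝ) / 2 ^ 5)
        (indHG (copyHG (F.induce ({w}ᶜ : Set (Fin (s + 1)))) G' G) W)) :
    ((Finset.univ.filter fun A : Finset (Fin m) =>
        ∃ B ⊆ A, (m : ℝ) / 8 ≤ (B.card : ℝ) ∧
          copyHG F (extendGraph G' B) (extendGraph G A) = ∅).card : ℝ)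
      ≤ 2 * Real.exp (-(m : ℝ) / 2 ^ 7) * 2 ^ m := by
  have hk : 0 < k := by omega
  have hm : 0 < m := by omega
  choose c hc using exists_tag F w G' G
  set H := copyHG (F.induce ({w}ᶜ : Set (Fin (s + 1)))) G' G with hH
  have hcard : ∀ L ∈ H, L.card = s := by
    intro L hL
    rw [card_eq_of_mem_copyHG hL, Fintype.card_compl_set]
    simp
  by_cases hInd : TagFree H c ∅
  swap
  · rw [Finset.filter_false_of_mem, Finset.card_empty, Nat.cast_zero]
    · positivity
    · rintro A - ⟨B, hBA, -, hempty⟩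
      exact hInd ((tagFree_tagPair hc hBA hempty).mono _ _ (Finset.empty_subset _))
  have hk1 : (1 : ℝ) ≤ (k : ℝ) ^ 2 := one_le_pow₀ (by exact_mod_cast hk)
  have hm0 : (0 : ℝ) < m := by exact_mod_cast hm
  obtain ⟨p, hp⟩ : ∃ p : ℝ, p = 1 / (2 ^ 20 * (k : ℝ) ^ 2) := ⟨_, rfl⟩
  obtain ⟨r, hr⟩ : ∃ r : ℝ, r = p / (1 - p) := ⟨_, rfl⟩
  obtain ⟨β, hβ⟩ : ∃ β : ℝ, β = 1 / (2 ^ 9 * (k : ℝ) ^ 2) := ⟨_, rfl⟩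
  rw [← hp] at hJanson
  have hp0 : 0 < p := by rw [hp]; positivity
  have hp1 : p ≤ 1 / 2 ^ 20 := by
    rw [hp]
    exact one_div_le_one_div_of_le (by positivity) (by linarith)
  have hq : 0 < 1 - p := by linarith
  have hr0 : 0 < r := by rw [hr]; positivity
  have hβ0 : 0 < β := by rw [hβ]; positivity
  have hpβ : p = β / 2 ^ 11 := by
    rw [hp, hβ]
    field_simp
  have hrp : r ≤ 1.01 * β / 2 ^ 11 := by
    rw [hr, div_le_iff₀ hq]
    nlinarith
  have hβr : 0 < β * r := by positivity
  have hlog : 0 ≤ Real.log 512 := Real.log_nonneg (by norm_num)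
  obtain ⟨K, hKcard, hK, hcover⟩ := exists_containers (Ind := TagFree H c) TagFree.mono hr0.le
    (a := Real.log 512 / (β * r)) (b := 1 / 512) (by positivity) (by norm_num)
    (by
      rw [div_mul_cancel₀ _ hβr.ne', Real.exp_neg, Real.exp_log (by norm_num)]
      have := Real.add_one_le_exp (1 / 512 : ℝ)
      linarith)
    hβ0.le Finset.univ ∅
  have hJ : hardCorePotential (TagFree H c) r ∅ Finset.univ ≤ 1.01 * m / 2 ^ 10 * (β * r) := by
    refine (hardCorePotential_le hInd Finset.univ hr0.le).trans ?_
    have h1 : ((Finset.univ : Finset (Fin m × Bool)).card : ℝ) = 2 * m := by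
      simp [mul_comm]
    rw [h1]
    have h2 := mul_le_mul_of_nonneg_left hrp (by positivity : 0 ≤ 2 * (m : ℝ) * r)
    linarith
  have hK' : (K.card : ℝ) ≤ Real.exp (Real.log 512 * (1.01 * m / 2 ^ 10) + 2 * m / 512) := by
    refine hKcard.trans (Real.exp_le_exp.2 (add_le_add ?_ (le_of_eq ?_)))
    · rw [div_mul_eq_mul_div, div_le_iff₀ hβr]
      have := mul_le_mul_of_nonneg_left hJ hlog
      linarith
    · simp
      ring
  have hpiece : ∀ P ∈ K, ((Finset.univ.filter fun A : Finset (Fin m) =>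
      (∀ u, (u, false) ∉ P.1 ∪ P.2 → u ∈ A) ∧
        (m : ℝ) / 8 ≤ ((Finset.univ.filter fun u => (u, true) ∈ P.1 ∪ P.2).card : ℝ)).card : ℝ) ≤
      2 ^ m * Real.exp (-(Real.log 2 * ((m : ℝ) / 8 - 3 * m / 32 - 1.01 * m / 2 ^ 10))) := by
    intro P hP
    obtain ⟨hP1, hP2⟩ := hK P hP
    have h := card_filter_container_le P.1 P.2 (y := 3 * (m : ℝ) / 32) (z := 1.01 * m / 2 ^ 10)
      (x := (m : ℝ) / 8) ?_ ?_
    · rw [Fintype.card_fin] at h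
      convert h
    · by_contra! hlarge
      refine (hardCoreSum_tagFree_lt c hsk.le hk hm (Fintype.card_fin m) hcard hp hr hJanson
        hlarge.le).not_ge ?_
      rwa [← hβ]
    · rw [Finset.card_empty, Nat.cast_zero, zero_mul, zero_add] at hP1
      exact le_of_mul_le_mul_right (hP1.trans hJ) hβr
  have hsub : (Finset.univ.filter fun A : Finset (Fin m) =>
      ∃ B ⊆ A, (m : ℝ) / 8 ≤ (B.card : ℝ) ∧
        copyHG F (extendGraph G' B) (extendGraph G A) = ∅) ⊆
      K.biUnion fun P => Finset.univ.filter fun A : Finset (Fin m) =>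
        (∀ u, (u, false) ∉ P.1 ∪ P.2 → u ∈ A) ∧
          (m : ℝ) / 8 ≤ ((Finset.univ.filter fun u => (u, true) ∈ P.1 ∪ P.2).card : ℝ) := by
    intro A hA
    obtain ⟨B, hBA, hB, hempty⟩ := (Finset.mem_filter.1 hA).2
    obtain ⟨P, hP, hsubP⟩ := hcover (tagPair B A) (tagFree_tagPair hc hBA hempty)
      (Finset.empty_subset _) (by simp)
    refine Finset.mem_biUnion.2 ⟨P, hP, Finset.mem_filter.2 ⟨Finset.mem_univ _, fun u hu => ?_,
      hB.trans (Nat.cast_le.2 (Finset.card_le_card fun u hu => ?_))⟩⟩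
    · by_contra huA
      exact hu (hsubP (mem_tagPair_false.2 huA))
    · exact Finset.mem_filter.2 ⟨Finset.mem_univ _, hsubP (mem_tagPair_true.2 hu)⟩
  have hcount := (Nat.cast_le (α := ℝ).2 (Finset.card_le_card hsub)).trans
    (Nat.cast_le.2 Finset.card_biUnion_le)
  rw [Nat.cast_sum] at hcount
  refine hcount.trans ((Finset.sum_le_sum hpiece).trans ?_)
  rw [Finset.sum_const, nsmul_eq_mul]
  refine (mul_le_mul_of_nonneg_right hK' (by positivity)).trans ?_
  rw [mul_left_comm, ← Real.exp_add, ← sub_eq_add_neg]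
  have hexp := Real.exp_le_exp.2 (container_exponent_le hm0.le)
  have hfin := mul_le_mul_of_nonneg_left hexp (by positivity : (0 : ℝ) ≤ 2 ^ m)
  have hpos : 0 ≤ Real.exp (-(m : ℝ) / 2 ^ 7) * 2 ^ m := by positivity
  linarith

end
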